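/- Let w : ℝ → ℝ be smooth and 2π-periodic, define u(θ) = w′(θ) + ε(−w′(θ)² + w″(θ)²/2) and r_ε(s) = (1/(2π))(1 − ε·u(2πs))·(cos(2πs + ε·w(2πs)), sin(2πs + ε·w(2πs))), and set E_loc(ε) = ∫_0^1 ‖r_ε″(s)‖² ds (second derivative in s). Then there exists a constant C (depending only on w) such that for all ε ∈ [−1, 1], | E_loc(ε) − 4π² − 2ε²π ∫_0^{2π} ( w′(θ)² − 2 w″(θ)² + w‴(θ)² ) dθ | ≤ C|ε|³. -/

import Mathlib

open Real Filter

/-- The radial displacement `u(θ) = w′(θ) + ε(−w′(θ)² + w″(θ)²/2)` determined by the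
circumferential displacement `w` through the inextensibility condition. -/
noncomputable def uDisp (w : ℝ → ℝ) (ε θ : ℝ) : ℝ :=
  deriv w θ + ε * (-(deriv w θ) ^ 2 + (iteratedDeriv 2 w θ) ^ 2 / 2)

/-- The deformed-ring parametrization
`r_ε(s) = (1/(2π))(1 − ε u(2πs))·(cos(2πs + ε w(2πs)), sin(2πs + ε w(2πs)))`. -/
noncomputable def ringDeform (w : ℝ → ℝ) (ε s : ℝ) : ℝ × ℝ :=
  ((1 / (2 * π)) * (1 - ε * uDisp w ε (2 * π * s))) •
    (Real.cos (2 * π * s + ε * w (2 * π * s)), Real.sin (2 * π * s + ε * w (2 * π * s)))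

/-- The local (bending) part of the continuum energy of the deformed ring. -/
noncomputable def Eloc (w : ℝ → ℝ) (ε : ℝ) : ℝ :=
  ∫ s in (0 : ℝ)..1,
    ((iteratedDeriv 2 (ringDeform w ε) s).1 ^ 2 +
      (iteratedDeriv 2 (ringDeform w ε) s).2 ^ 2)

theorem sq_add_sq_iteratedDeriv_two_polar {ρ ρ₁ ρ₂ φ φ₁ φ₂ : ℝ → ℝ}
    (hρ : ∀ s, HasDerivAt ρ (ρ₁ s) s) (hρ₁ : ∀ s, HasDerivAt ρ₁ (ρ₂ s) s)
    (hφ : ∀ s, HasDerivAt φ (φ₁ s) s) (hφ₁ : ∀ s, HasDerivAt φ₁ (φ₂ s) s) (s : ℝ) :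
    (iteratedDeriv 2 (fun t => ρ t • (Real.cos (φ t), Real.sin (φ t))) s).1 ^ 2 +
      (iteratedDeriv 2 (fun t => ρ t • (Real.cos (φ t), Real.sin (φ t))) s).2 ^ 2 =
    (ρ₂ s - ρ s * φ₁ s ^ 2) ^ 2 + (2 * ρ₁ s * φ₁ s + ρ s * φ₂ s) ^ 2 := by
  have h₁ : deriv (fun t => ρ t • (Real.cos (φ t), Real.sin (φ t))) = fun t =>
      (ρ₁ t * Real.cos (φ t) + ρ t * (-Real.sin (φ t) * φ₁ t),
        ρ₁ t * Real.sin (φ t) + ρ t * (Real.cos (φ t) * φ₁ t)) := by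
    funext t
    exact (((hρ t).mul (hφ t).cos).prodMk ((hρ t).mul (hφ t).sin)).deriv
  have h₂ := ((((hρ₁ s).mul (hφ s).cos).add
      ((hρ s).mul ((hφ s).sin.neg.mul (hφ₁ s)))).prodMk
    (((hρ₁ s).mul (hφ s).sin).add ((hρ s).mul ((hφ s).cos.mul (hφ₁ s))))).deriv
  rw [iteratedDeriv_succ, iteratedDeriv_one, h₁]
  erw [h₂]
  simp only [Pi.neg_apply, Pi.mul_apply]
  linear_combination ((ρ₂ s - ρ s * φ₁ s ^ 2) ^ 2 + (2 * ρ₁ s * φ₁ s + ρ s * φ₂ s) ^ 2) *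
    Real.sin_sq_add_cos_sq (φ s)

theorem Function.Periodic.iteratedDeriv {f : ℝ → ℝ} {c : ℝ} (hf : Function.Periodic f c) (n : ℕ) :
    Function.Periodic (iteratedDeriv n f) c := by
  intro x
  have h := congrFun (iteratedDeriv_comp_add_const n f c) x
  rw [← h]
  exact congrArg (fun g => _root_.iteratedDeriv n g x) (funext hf)

theorem ContDiff.hasDerivAt_iteratedDeriv {f : ℝ → ℝ} (hf : ContDiff ℝ (⊤ : ℕ∞) f) (n : ℕ) (x : ℝ) :
    HasDerivAt (iteratedDeriv n f) (iteratedDeriv (n + 1) f x) x := by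
  rw [iteratedDeriv_succ]
  exact ((hf.differentiable_iteratedDeriv n
    (by exact_mod_cast WithTop.coe_lt_top n)) x).hasDerivAt

/-- The second-order coefficient `b = -w′² + w″²/2` of the radial displacement, given
`a = w′` and `a₁ = w″`. -/
noncomputable def radialCoeff (a a₁ : ℝ) : ℝ := -a ^ 2 + a₁ ^ 2 / 2

/-- The derivative of `radialCoeff` along the ring. -/
noncomputable def radialCoeffDeriv (a a₁ a₂ : ℝ) : ℝ := -2 * a * a₁ + a₁ * a₂

/-- The second derivative of `radialCoeff` along the ring. -/
noncomputable def radialCoeffDerivTwo (a a₁ a₂ a₃ : ℝ) : ℝ :=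
  -2 * a₁ ^ 2 - 2 * a * a₂ + a₂ ^ 2 + a₁ * a₃

/-- The bending energy density in the angular variable, normalized to be `1` for the circle. -/
noncomputable def bendingDensity (ε a a₁ a₂ a₃ : ℝ) : ℝ :=
  (-ε * a₂ - ε ^ 2 * radialCoeffDerivTwo a a₁ a₂ a₃ -
      (1 - ε * a - ε ^ 2 * radialCoeff a a₁) * (1 + ε * a) ^ 2) ^ 2 +
    (2 * (-ε * a₁ - ε ^ 2 * radialCoeffDeriv a a₁ a₂) * (1 + ε * a) +
      (1 - ε * a - ε ^ 2 * radialCoeff a a₁) * (ε * a₁)) ^ 2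

/-- The cubic remainder of `bendingDensity`, divided by `ε ^ 3`. -/
noncomputable def bendingRemainder (ε a a₁ a₂ a₃ : ℝ) : ℝ :=
  let b := radialCoeff a a₁
  let b₁ := radialCoeffDeriv a a₁ a₂
  let b₂ := radialCoeffDerivTwo a a₁ a₂ a₃
  let c := (-b₂ + b + a ^ 2) + ε * (a ^ 3 + 2 * a * b) + ε ^ 2 * (a ^ 2 * b)
  let d := (-2 * b₁ - 3 * a * a₁) + ε * (-2 * a * b₁ - b * a₁)
  ε * (c ^ 2 + d ^ 2) - 2 * (a₂ + a) * c - 2 * a₁ * d -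
    2 * (a ^ 3 + 2 * a * b + ε * (a ^ 2 * b))

@[fun_prop]
theorem Continuous.radialCoeffDerivTwo {X : Type*} [TopologicalSpace X] {a a₁ a₂ a₃ : X → ℝ}
    (ha : Continuous a) (ha₁ : Continuous a₁) (ha₂ : Continuous a₂) (ha₃ : Continuous a₃) :
    Continuous fun x => radialCoeffDerivTwo (a x) (a₁ x) (a₂ x) (a₃ x) := by
  simp only [_root_.radialCoeffDerivTwo]
  fun_prop

@[fun_prop]
theorem Continuous.bendingRemainder {X : Type*} [TopologicalSpace X] {ε a a₁ a₂ a₃ : X → ℝ}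
    (hε : Continuous ε) (ha : Continuous a) (ha₁ : Continuous a₁) (ha₂ : Continuous a₂)
    (ha₃ : Continuous a₃) :
    Continuous fun x => bendingRemainder (ε x) (a x) (a₁ x) (a₂ x) (a₃ x) := by
  simp only [_root_.bendingRemainder, radialCoeff, radialCoeffDeriv]
  fun_prop

theorem bendingDensity_eq (ε a a₁ a₂ a₃ : ℝ) :
    bendingDensity ε a a₁ a₂ a₃ =
      1 + ε ^ 2 * (a ^ 2 - 2 * a₁ ^ 2 + a₂ ^ 2) +
        (ε * (2 * a₂ + 2 * a) +
          ε ^ 2 * (2 * (a₁ * a₁ + a * a₂) + 2 * radialCoeffDerivTwo a a₁ a₂ a₃)) +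
        ε ^ 3 * bendingRemainder ε a a₁ a₂ a₃ := by
  simp only [bendingDensity, bendingRemainder, radialCoeff]
  ring

section Smooth

variable {w : ℝ → ℝ}

theorem hasDerivAt_radialCoeff (hw : ContDiff ℝ (⊤ : ℕ∞) w) (θ : ℝ) :
    HasDerivAt (fun θ => radialCoeff (iteratedDeriv 1 w θ) (iteratedDeriv 2 w θ))
      (radialCoeffDeriv (iteratedDeriv 1 w θ) (iteratedDeriv 2 w θ) (iteratedDeriv 3 w θ)) θ := by
  have h := ((hw.hasDerivAt_iteratedDeriv 1 θ).pow 2).neg.add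
    (((hw.hasDerivAt_iteratedDeriv 2 θ).pow 2).div_const 2)
  refine h.congr_deriv ?_
  simp only [radialCoeffDeriv]
  push_cast
  ring

theorem hasDerivAt_radialCoeffDeriv (hw : ContDiff ℝ (⊤ : ℕ∞) w) (θ : ℝ) :
    HasDerivAt
      (fun θ => radialCoeffDeriv (iteratedDeriv 1 w θ) (iteratedDeriv 2 w θ) (iteratedDeriv 3 w θ))
      (radialCoeffDerivTwo (iteratedDeriv 1 w θ) (iteratedDeriv 2 w θ) (iteratedDeriv 3 w θ)
        (iteratedDeriv 4 w θ)) θ := by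
  have h₁ := hw.hasDerivAt_iteratedDeriv 1 θ
  have h₂ := hw.hasDerivAt_iteratedDeriv 2 θ
  have h₃ := hw.hasDerivAt_iteratedDeriv 3 θ
  have h := ((h₁.const_mul (-2)).mul h₂).add (h₂.mul h₃)
  refine h.congr_deriv ?_
  simp only [radialCoeffDerivTwo]
  ring

theorem ringDeform_density (hw : ContDiff ℝ (⊤ : ℕ∞) w) (ε s : ℝ) :
    (iteratedDeriv 2 (ringDeform w ε) s).1 ^ 2 + (iteratedDeriv 2 (ringDeform w ε) s).2 ^ 2 =
      4 * π ^ 2 * bendingDensity ε (iteratedDeriv 1 w (2 * π * s)) (iteratedDeriv 2 w (2 * π * s))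
        (iteratedDeriv 3 w (2 * π * s)) (iteratedDeriv 4 w (2 * π * s)) := by
  have hπ : π ≠ 0 := Real.pi_ne_zero
  have scale {f f' : ℝ → ℝ} (hf : ∀ θ, HasDerivAt f (f' θ) θ) (s : ℝ) :
      HasDerivAt (fun s => f (2 * π * s)) (2 * π * f' (2 * π * s)) s := by
    have h := (hf (2 * π * s)).comp s ((hasDerivAt_id s).const_mul (2 * π))
    refine h.congr_deriv ?_
    ring
  have hρ (θ : ℝ) := (((((hw.hasDerivAt_iteratedDeriv 1 θ).fun_add
    ((hasDerivAt_radialCoeff hw θ).const_mul ε)).const_mul ε).const_sub 1).const_mul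
      (1 / (2 * π)))
  have hρ₁ (θ : ℝ) := (((((hw.hasDerivAt_iteratedDeriv 2 θ).fun_add
    ((hasDerivAt_radialCoeffDeriv hw θ).const_mul ε)).const_mul ε).fun_neg).const_mul
      (1 / (2 * π)))
  have hφ (θ : ℝ) := (hasDerivAt_id' θ).fun_add ((hw.hasDerivAt_iteratedDeriv 0 θ).const_mul ε)
  have hφ₁ (θ : ℝ) := ((hw.hasDerivAt_iteratedDeriv 1 θ).const_mul ε).const_add 1
  have key := sq_add_sq_iteratedDeriv_two_polar (scale hρ)
    (fun s => (scale hρ₁ s).const_mul (2 * π)) (scale hφ)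
    (fun s => (scale hφ₁ s).const_mul (2 * π)) s
  have hr : ringDeform w ε = fun t => (1 / (2 * π) * (1 - ε * (iteratedDeriv 1 w (2 * π * t) +
        ε * radialCoeff (iteratedDeriv 1 w (2 * π * t)) (iteratedDeriv 2 w (2 * π * t))))) •
      (Real.cos (2 * π * t + ε * iteratedDeriv 0 w (2 * π * t)),
        Real.sin (2 * π * t + ε * iteratedDeriv 0 w (2 * π * t))) := by
    funext t
    simp only [ringDeform, uDisp, radialCoeff, iteratedDeriv_one, iteratedDeriv_zero]
  rw [hr, key]
  simp only [bendingDensity, zero_add, Nat.reduceAdd]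
  field_simp
  ring

theorem Eloc_eq_integral_bendingDensity (hw : ContDiff ℝ (⊤ : ℕ∞) w) (ε : ℝ) :
    Eloc w ε = 2 * π * ∫ θ in (0 : ℝ)..(2 * π),
      bendingDensity ε (iteratedDeriv 1 w θ) (iteratedDeriv 2 w θ) (iteratedDeriv 3 w θ)
        (iteratedDeriv 4 w θ) := by
  simp only [Eloc, ringDeform_density hw]
  rw [intervalIntegral.integral_const_mul]
  have h := intervalIntegral.mul_integral_comp_mul_left (a := 0) (b := 1)
    (f := fun θ => bendingDensity ε (iteratedDeriv 1 w θ) (iteratedDeriv 2 w θ)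
      (iteratedDeriv 3 w θ) (iteratedDeriv 4 w θ)) (2 * π)
  rw [mul_zero, mul_one] at h
  rw [← h]
  ring

theorem integral_bending_null_lagrangian (hw : ContDiff ℝ (⊤ : ℕ∞) w)
    (hper : Function.Periodic w (2 * π)) (ε : ℝ) :
    ∫ θ in (0 : ℝ)..(2 * π),
      (ε * (2 * iteratedDeriv 3 w θ + 2 * iteratedDeriv 1 w θ) +
        ε ^ 2 * (2 * (iteratedDeriv 2 w θ * iteratedDeriv 2 w θ +
            iteratedDeriv 1 w θ * iteratedDeriv 3 w θ) +
          2 * radialCoeffDerivTwo (iteratedDeriv 1 w θ) (iteratedDeriv 2 w θ)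
            (iteratedDeriv 3 w θ) (iteratedDeriv 4 w θ))) = 0 := by
  have hc (n : ℕ) : Continuous (iteratedDeriv n w) :=
    hw.continuous_iteratedDeriv n (by exact_mod_cast le_top)
  have hp (n : ℕ) : iteratedDeriv n w (2 * π) = iteratedDeriv n w 0 := by
    simpa using hper.iteratedDeriv n 0
  have hd (n : ℕ) (θ : ℝ) := hw.hasDerivAt_iteratedDeriv n θ
  rw [intervalIntegral.integral_eq_sub_of_hasDerivAt (fun θ _ =>
    ((((hd 2 θ).const_mul 2).add ((hd 0 θ).const_mul 2)).const_mul ε).add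
      (((((hd 1 θ).mul (hd 2 θ)).const_mul 2).add
        ((hasDerivAt_radialCoeffDeriv hw θ).const_mul 2)).const_mul (ε ^ 2)))]
  · simp only [Pi.add_apply, Pi.mul_apply, hp, sub_self]
  · apply Continuous.intervalIntegrable
    have := hc 1
    have := hc 2
    have := hc 3
    have := hc 4
    fun_prop

theorem exists_bound_bendingRemainder (hw : ContDiff ℝ (⊤ : ℕ∞) w) :
    ∃ C, ∀ ε ∈ Set.Icc (-1 : ℝ) 1, ∀ θ ∈ Set.Icc 0 (2 * π),
      |bendingRemainder ε (iteratedDeriv 1 w θ) (iteratedDeriv 2 w θ) (iteratedDeriv 3 w θ)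
        (iteratedDeriv 4 w θ)| ≤ C := by
  have hc (n : ℕ) : Continuous (iteratedDeriv n w) :=
    hw.continuous_iteratedDeriv n (by exact_mod_cast le_top)
  have h₁ := hc 1
  have h₂ := hc 2
  have h₃ := hc 3
  have h₄ := hc 4
  have hR : Continuous fun p : ℝ × ℝ => bendingRemainder p.1 (iteratedDeriv 1 w p.2)
      (iteratedDeriv 2 w p.2) (iteratedDeriv 3 w p.2) (iteratedDeriv 4 w p.2) := by
    fun_prop
  obtain ⟨C, hC⟩ := (isCompact_Icc.prod isCompact_Icc).exists_bound_of_continuousOn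
    (s := Set.Icc (-1 : ℝ) 1 ×ˢ Set.Icc 0 (2 * π)) hR.continuousOn
  exact ⟨C, fun ε hε θ hθ => hC (ε, θ) ⟨hε, hθ⟩⟩

end Smooth

/-- Expansion of the local bending energy of the deformed ring:
`E_loc(ε) = 4π² + 2ε²π ∫₀^{2π} (w′² − 2w″² + w‴²) dθ + O(ε³)`. -/
theorem Eloc_expansion (w : ℝ → ℝ) (hw : ContDiff ℝ (⊤ : ℕ∞) w)
    (hper : Function.Periodic w (2 * π)) :
    ∃ C : ℝ, ∀ ε ∈ Set.Icc (-1 : ℝ) 1,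
      |Eloc w ε - 4 * π ^ 2 -
          2 * ε ^ 2 * π *
            ∫ θ in (0 : ℝ)..(2 * π),
              ((deriv w θ) ^ 2 - 2 * (iteratedDeriv 2 w θ) ^ 2 +
                (iteratedDeriv 3 w θ) ^ 2)| ≤
        C * |ε| ^ 3 := by
  obtain ⟨C, hC⟩ := exists_bound_bendingRemainder hw
  refine ⟨2 * π * (C * (2 * π)), fun ε hε => ?_⟩
  have hπ := Real.pi_pos
  have hc (n : ℕ) : Continuous (iteratedDeriv n w) :=
    hw.continuous_iteratedDeriv n (by exact_mod_cast le_top)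
  have h₁ := hc 1
  have h₂ := hc 2
  have h₃ := hc 3
  have h₄ := hc 4
  have hbound : |∫ θ in (0 : ℝ)..(2 * π), bendingRemainder ε (iteratedDeriv 1 w θ)
      (iteratedDeriv 2 w θ) (iteratedDeriv 3 w θ) (iteratedDeriv 4 w θ)| ≤ C * (2 * π) := by
    have h := intervalIntegral.norm_integral_le_of_norm_le_const (a := 0) (b := 2 * π)
      (f := fun θ => bendingRemainder ε (iteratedDeriv 1 w θ)
        (iteratedDeriv 2 w θ) (iteratedDeriv 3 w θ) (iteratedDeriv 4 w θ)) (C := C)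
      fun θ hθ => hC ε hε θ (by
        rw [Set.uIoc_of_le (by positivity)] at hθ
        exact Set.Ioc_subset_Icc_self hθ)
    rwa [sub_zero, abs_of_pos (by positivity), Real.norm_eq_abs] at h
  have hsplit : Eloc w ε = 2 * π * (2 * π + ε ^ 2 * (∫ θ in (0 : ℝ)..(2 * π),
      ((iteratedDeriv 1 w θ) ^ 2 - 2 * (iteratedDeriv 2 w θ) ^ 2 + (iteratedDeriv 3 w θ) ^ 2)) +
      ε ^ 3 * ∫ θ in (0 : ℝ)..(2 * π), bendingRemainder ε (iteratedDeriv 1 w θ)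
        (iteratedDeriv 2 w θ) (iteratedDeriv 3 w θ) (iteratedDeriv 4 w θ)) := by
    rw [Eloc_eq_integral_bendingDensity hw]
    simp only [bendingDensity_eq]
    rw [intervalIntegral.integral_add, intervalIntegral.integral_add,
      integral_bending_null_lagrangian hw hper, intervalIntegral.integral_add,
      intervalIntegral.integral_const_mul, intervalIntegral.integral_const_mul,
      intervalIntegral.integral_const]
    · simp
    all_goals
      apply Continuous.intervalIntegrable
      fun_prop
  simp only [iteratedDeriv_one] at hsplit hbound
  rw [hsplit]
  calc
    _ = 2 * π * |∫ θ in (0 : ℝ)..(2 * π), bendingRemainder ε (deriv w θ)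
        (iteratedDeriv 2 w θ) (iteratedDeriv 3 w θ) (iteratedDeriv 4 w θ)| * |ε| ^ 3 := by
      rw [← abs_of_pos (show 0 < 2 * π by positivity), ← abs_pow, ← abs_mul, ← abs_mul,
        abs_of_pos (show 0 < 2 * π by positivity)]
      congr 1
      ring
    _ ≤ _ := by gcongr
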